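/- Desynchronization property of Haar-random orthogonal matrices: There exist constants C ≥ 1 and c > 0 such that for all integers N ≥ 2 and d ≥ 1 and all unit vectors x, y ∈ ℝ^d, if R is drawn from the Haar probability measure μ on the orthogonal group O(d), then Pr[ |⟨Rx, y⟩| > C·√(log N)/√d ] ≤ N^{−c}. -/

import Mathlib

open MeasureTheory

noncomputable instance (d : ℕ) : MeasurableSpace (Matrix.orthogonalGroup (Fin d) ℝ) :=
  borel _

instance (d : ℕ) : BorelSpace (Matrix.orthogonalGroup (Fin d) ℝ) := ⟨rfl⟩

/-- The standard inner product on `ℝ^d` (vectors as functions `Fin d → ℝ`). -/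
def ip {d : ℕ} (v w : Fin d → ℝ) : ℝ := ∑ i, v i * w i

open Matrix in
/-- Householder reflection exchanging two vectors of the same length. -/
theorem exists_reflection {d : ℕ} (w z : Fin d → ℝ) (h : w ⬝ᵥ w = z ⬝ᵥ z) :
    ∃ Q : Matrix.orthogonalGroup (Fin d) ℝ,
      ∀ u : Fin d → ℝ, ((Q : Matrix (Fin d) (Fin d) ℝ) *ᵥ u) ⬝ᵥ w = u ⬝ᵥ z := by
  by_cases hv : (w - z) ⬝ᵥ (w - z) = 0
  · have : w - z = 0 := dotProduct_self_eq_zero.mp hv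
    have hwz : w = z := sub_eq_zero.mp this
    exact ⟨1, fun u => by simp [hwz]⟩
  · set v := w - z with hvdef
    set a : ℝ := 2 / (v ⬝ᵥ v) with ha
    have hmem : (1 - a • vecMulVec v v) ∈ Matrix.orthogonalGroup (Fin d) ℝ := by
      rw [Matrix.mem_orthogonalGroup_iff]
      have hs : (1 - a • vecMulVec v v)ᵀ = 1 - a • vecMulVec v v := by
        ext i j
        simp [Matrix.vecMulVec_apply, Matrix.one_apply, eq_comm, mul_comm]
      have hsq : vecMulVec v v * vecMulVec v v = (v ⬝ᵥ v) • vecMulVec v v := by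
        ext i j
        simp only [Matrix.mul_apply, Matrix.vecMulVec_apply, Matrix.smul_apply, smul_eq_mul,
          dotProduct, Finset.sum_mul]
        exact Finset.sum_congr rfl fun k _ => by ring
      have haa : a * a * (v ⬝ᵥ v) = 2 * a := by
        rw [ha]; field_simp
      rw [hs, sub_mul, mul_sub, mul_sub, one_mul, one_mul, mul_one, smul_mul_smul_comm, hsq,
        smul_smul, haa, two_mul, add_smul]
      abel
    refine ⟨⟨_, hmem⟩, fun u => ?_⟩
    have h1 : (1 - a • vecMulVec v v) *ᵥ u = u - (a * (v ⬝ᵥ u)) • v := by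
      rw [Matrix.sub_mulVec, Matrix.one_mulVec, Matrix.smul_mulVec, Matrix.vecMulVec_mulVec]
      ext i
      simp
      ring
    show ((1 - a • vecMulVec v v) *ᵥ u) ⬝ᵥ w = _
    rw [h1, sub_dotProduct, smul_dotProduct, smul_eq_mul]
    have h2 : v ⬝ᵥ v = 2 * (v ⬝ᵥ w) := by
      have h3 := dotProduct_comm w z
      simp only [hvdef, sub_dotProduct, dotProduct_sub]
      linarith
    have h4 : a * (v ⬝ᵥ w) = 1 := by
      rw [ha]
      have : v ⬝ᵥ w = (v ⬝ᵥ v) / 2 := by linarith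
      rw [this]; field_simp
    have h5 : a * (v ⬝ᵥ u) * (v ⬝ᵥ w) = v ⬝ᵥ u := by
      rw [mul_right_comm, h4, one_mul]
    rw [h5, hvdef, sub_dotProduct, dotProduct_comm w u, dotProduct_comm z u]
    ring

open Matrix in
theorem continuous_ip {d : ℕ} (x w : Fin d → ℝ) :
    Continuous fun R : Matrix.orthogonalGroup (Fin d) ℝ =>
      ((R : Matrix (Fin d) (Fin d) ℝ) *ᵥ x) ⬝ᵥ w :=
  (continuous_subtype_val.matrix_mulVec continuous_const).dotProduct continuous_const

open Matrix in
theorem lintegral_exp_inv {d : ℕ} (μ : Measure (Matrix.orthogonalGroup (Fin d) ℝ))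
    [μ.IsHaarMeasure] (x w z : Fin d → ℝ) (h : w ⬝ᵥ w = z ⬝ᵥ z) :
    ∫⁻ R, ENNReal.ofReal (Real.exp (((R : Matrix (Fin d) (Fin d) ℝ) *ᵥ x) ⬝ᵥ w)) ∂μ =
    ∫⁻ R, ENNReal.ofReal (Real.exp (((R : Matrix (Fin d) (Fin d) ℝ) *ᵥ x) ⬝ᵥ z)) ∂μ := by
  obtain ⟨Q, hQ⟩ := exists_reflection w z h
  rw [← lintegral_mul_left_eq_self _ Q]
  refine lintegral_congr fun R => ?_
  rw [← hQ, Submonoid.coe_mul, ← Matrix.mulVec_mulVec]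

open Matrix in
theorem orth_norm {d : ℕ} (R : Matrix.orthogonalGroup (Fin d) ℝ) (x : Fin d → ℝ) :
    ((R : Matrix (Fin d) (Fin d) ℝ) *ᵥ x) ⬝ᵥ ((R : Matrix (Fin d) (Fin d) ℝ) *ᵥ x) = x ⬝ᵥ x := by
  have h := (Matrix.mem_orthogonalGroup_iff' (Fin d) ℝ).mp R.2
  rw [Matrix.dotProduct_mulVec, ← Matrix.mulVec_transpose, Matrix.mulVec_mulVec, h,
    Matrix.one_mulVec]

/-- The sign attached to a Boolean. -/
def sgnB (b : Bool) : ℝ := if b then 1 else -1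

open Matrix in
theorem sum_signs {d : ℕ} (u : Fin d → ℝ) (s : ℝ) (hu : u ⬝ᵥ u = 1) :
    ∑ e : Fin d → Bool, Real.exp (u ⬝ᵥ fun i => s * sgnB (e i)) ≤
      2 ^ d * Real.exp (s ^ 2 / 2) := by
  have h1 : ∑ e : Fin d → Bool, Real.exp (u ⬝ᵥ fun i => s * sgnB (e i)) =
      ∏ i, ∑ b : Bool, Real.exp (u i * (s * sgnB b)) := by
    rw [Finset.prod_univ_sum, Fintype.piFinset_univ]
    exact Finset.sum_congr rfl fun e _ => by rw [dotProduct, Real.exp_sum]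
  have h2 : ∀ i, ∑ b : Bool, Real.exp (u i * (s * sgnB b)) = 2 * Real.cosh (u i * s) := by
    intro i
    rw [Fintype.sum_bool, Real.cosh_eq]
    simp [sgnB]
    ring
  rw [h1]
  calc ∏ i, ∑ b : Bool, Real.exp (u i * (s * sgnB b))
      ≤ ∏ i, (2 * Real.exp ((u i * s) ^ 2 / 2)) := by
        refine Finset.prod_le_prod (fun i _ => by positivity) fun i _ => ?_
        rw [h2]
        have := Real.cosh_le_exp_half_sq (u i * s)
        linarith
    _ = 2 ^ d * Real.exp (s ^ 2 / 2) := by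
        rw [Finset.prod_mul_distrib, ← Real.exp_sum]
        simp only [Finset.prod_const, Finset.card_univ, Fintype.card_fin]
        congr 2
        have : ∑ i, (u i * s) ^ 2 / 2 = (u ⬝ᵥ u) * (s ^ 2 / 2) := by
          rw [dotProduct, Finset.sum_mul]
          exact Finset.sum_congr rfl fun i _ => by ring
        rw [this, hu, one_mul]

open Matrix in
theorem mgf_bound {d : ℕ} (μ : Measure (Matrix.orthogonalGroup (Fin d) ℝ))
    [μ.IsHaarMeasure] [IsProbabilityMeasure μ] (x w : Fin d → ℝ) (s : ℝ) (hx : x ⬝ᵥ x = 1)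
    (hw : w ⬝ᵥ w = s ^ 2 * d) :
    ∫⁻ R, ENNReal.ofReal (Real.exp (((R : Matrix (Fin d) (Fin d) ℝ) *ᵥ x) ⬝ᵥ w)) ∂μ ≤
      ENNReal.ofReal (Real.exp (s ^ 2 / 2)) := by
  set I := ∫⁻ R, ENNReal.ofReal (Real.exp (((R : Matrix (Fin d) (Fin d) ℝ) *ᵥ x) ⬝ᵥ w)) ∂μ
    with hI
  have h1 : ∀ e : Fin d → Bool,
      ∫⁻ R, ENNReal.ofReal (Real.exp (((R : Matrix (Fin d) (Fin d) ℝ) *ᵥ x) ⬝ᵥ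
        fun i => s * sgnB (e i))) ∂μ = I := by
    intro e
    refine lintegral_exp_inv μ x _ w ?_
    rw [hw, dotProduct]
    have : ∀ i, s * sgnB (e i) * (s * sgnB (e i)) = s ^ 2 := by
      intro i
      cases e i <;> simp [sgnB] <;> ring
    simp [this, mul_comm]
  have h2 : (2 : ENNReal) ^ d * I ≤ 2 ^ d * ENNReal.ofReal (Real.exp (s ^ 2 / 2)) := by
    calc (2 : ENNReal) ^ d * I = ∑ e : Fin d → Bool, I := by simp
      _ = ∑ e : Fin d → Bool, ∫⁻ R, ENNReal.ofReal (Real.exp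
            (((R : Matrix (Fin d) (Fin d) ℝ) *ᵥ x) ⬝ᵥ fun i => s * sgnB (e i))) ∂μ :=
          Finset.sum_congr rfl fun e _ => (h1 e).symm
      _ = ∫⁻ R, ∑ e : Fin d → Bool, ENNReal.ofReal (Real.exp
            (((R : Matrix (Fin d) (Fin d) ℝ) *ᵥ x) ⬝ᵥ fun i => s * sgnB (e i))) ∂μ := by
          rw [lintegral_finsetSum]
          intro e _
          exact (Real.continuous_exp.comp (continuous_ip x _)).measurable.ennreal_ofReal
      _ ≤ ∫⁻ R, ENNReal.ofReal (2 ^ d * Real.exp (s ^ 2 / 2)) ∂μ := by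
          refine lintegral_mono fun R => ?_
          rw [← ENNReal.ofReal_sum_of_nonneg (fun _ _ => (Real.exp_pos _).le)]
          exact ENNReal.ofReal_le_ofReal (sum_signs _ s ((orth_norm R x).trans hx))
      _ = 2 ^ d * ENNReal.ofReal (Real.exp (s ^ 2 / 2)) := by
          rw [lintegral_const, measure_univ, mul_one, ENNReal.ofReal_mul (by positivity),
            ENNReal.ofReal_pow (by norm_num)]
          simp
  exact (ENNReal.mul_le_mul_iff_right (by simp) (by simp)).mp h2

open Matrix in
theorem tail_bound {d : ℕ} (hd : 1 ≤ d) (μ : Measure (Matrix.orthogonalGroup (Fin d) ℝ))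
    [μ.IsHaarMeasure] [IsProbabilityMeasure μ] (x y : Fin d → ℝ) (t : ℝ) (ht : 0 ≤ t)
    (hx : x ⬝ᵥ x = 1) (hy : y ⬝ᵥ y = 1) :
    μ {R | t / Real.sqrt d < ((R : Matrix (Fin d) (Fin d) ℝ) *ᵥ x) ⬝ᵥ y} ≤
      ENNReal.ofReal (Real.exp (-(t ^ 2 / 2))) := by
  have hd' : (0 : ℝ) < d := by exact_mod_cast hd
  have hsd : 0 < Real.sqrt d := Real.sqrt_pos.mpr hd'
  set w : Fin d → ℝ := (t * Real.sqrt d) • y with hw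
  have hww : w ⬝ᵥ w = t ^ 2 * d := by
    rw [hw, smul_dotProduct, dotProduct_smul, hy, smul_eq_mul, smul_eq_mul]
    have := Real.mul_self_sqrt hd'.le
    linear_combination t ^ 2 * this
  have hm := mgf_bound μ x w t hx hww
  have hmeas : Measurable fun R : Matrix.orthogonalGroup (Fin d) ℝ =>
      ENNReal.ofReal (Real.exp (((R : Matrix (Fin d) (Fin d) ℝ) *ᵥ x) ⬝ᵥ w)) :=
    (Real.continuous_exp.comp (continuous_ip x _)).measurable.ennreal_ofReal
  have hmk := mul_meas_ge_le_lintegral (μ := μ) hmeas (ENNReal.ofReal (Real.exp (t ^ 2)))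
  have hsub : μ {R | t / Real.sqrt d < ((R : Matrix (Fin d) (Fin d) ℝ) *ᵥ x) ⬝ᵥ y} ≤
      μ {R | ENNReal.ofReal (Real.exp (t ^ 2)) ≤
        ENNReal.ofReal (Real.exp (((R : Matrix (Fin d) (Fin d) ℝ) *ᵥ x) ⬝ᵥ w))} := by
    refine measure_mono fun R hR => ?_
    simp only [Set.mem_ofPred_eq] at hR ⊢
    refine ENNReal.ofReal_le_ofReal (Real.exp_le_exp.mpr ?_)
    rw [hw, dotProduct_smul, smul_eq_mul]
    rw [div_lt_iff₀ hsd] at hR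
    nlinarith [mul_le_mul_of_nonneg_left hR.le ht]
  have hpos : ENNReal.ofReal (Real.exp (t ^ 2)) ≠ 0 := by
    simp [Real.exp_pos]
  refine hsub.trans ((ENNReal.mul_le_mul_iff_right hpos ENNReal.ofReal_ne_top).mp ?_)
  refine (hmk.trans hm).trans (le_of_eq ?_)
  rw [← ENNReal.ofReal_mul (Real.exp_pos _).le, ← Real.exp_add]
  congr 2
  ring

/-- **Desynchronization property of Haar-random orthogonal matrices.**
There exist constants `C ≥ 1` and `c > 0` such that for all integers `N ≥ 2` and `d ≥ 1`
and all unit vectors `x, y ∈ ℝ^d`, if `R` is drawn from the Haar probability measure on the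
orthogonal group `O(d)`, then `Pr[ |⟨Rx, y⟩| > C·√(log N)/√d ] ≤ N^{−c}`. -/
theorem haar_orthogonal_desynchronization :
    ∃ C : ℝ, 1 ≤ C ∧ ∃ c : ℝ, 0 < c ∧
      ∀ (N d : ℕ), 2 ≤ N → 1 ≤ d →
      ∀ x y : Fin d → ℝ, (∑ i, x i ^ 2) = 1 → (∑ i, y i ^ 2) = 1 →
      ∀ μ : Measure (Matrix.orthogonalGroup (Fin d) ℝ),
        μ.IsHaarMeasure → IsProbabilityMeasure μ →
        μ {R : Matrix.orthogonalGroup (Fin d) ℝ |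
            C * Real.sqrt (Real.log N) / Real.sqrt d <
              |ip ((R : Matrix (Fin d) (Fin d) ℝ).mulVec x) y|}
          ≤ ENNReal.ofReal ((N : ℝ) ^ (-c : ℝ)) := by
  refine ⟨2, by norm_num, 1, one_pos, ?_⟩
  intro N d hN hd x y hx hy μ hμ hP
  have hN' : (2 : ℝ) ≤ N := by exact_mod_cast hN
  have hN0 : (0 : ℝ) < N := by linarith
  have hlog : 0 ≤ Real.log N := Real.log_nonneg (by linarith)
  have hx' : x ⬝ᵥ x = 1 := by rw [← hx]; exact Finset.sum_congr rfl fun i _ => by ring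
  have hy' : y ⬝ᵥ y = 1 := by rw [← hy]; exact Finset.sum_congr rfl fun i _ => by ring
  have hny : (-y) ⬝ᵥ (-y) = 1 := by rw [neg_dotProduct_neg, hy']
  have ht : 0 ≤ 2 * Real.sqrt (Real.log N) := by positivity
  have h1 := tail_bound hd μ x y _ ht hx' hy'
  have h2 := tail_bound hd μ x (-y) _ ht hx' hny
  have hexp : Real.exp (-((2 * Real.sqrt (Real.log N)) ^ 2 / 2)) = ((N : ℝ) ^ 2)⁻¹ := by
    rw [mul_pow, Real.sq_sqrt hlog, Real.exp_neg]
    congr 1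
    rw [show (2 : ℝ) ^ 2 * Real.log N / 2 = Real.log N + Real.log N by ring, Real.exp_add,
      Real.exp_log hN0, sq]
  rw [hexp] at h1 h2
  refine (measure_mono ?_).trans ((measure_union_le _ _).trans ((add_le_add h1 h2).trans ?_))
  · intro R hR
    rw [Set.mem_ofPred_eq] at hR
    rcases lt_abs.mp hR with h | h
    · refine Or.inl ?_
      rw [Set.mem_ofPred_eq]
      exact h
    · refine Or.inr ?_
      rw [Set.mem_ofPred_eq, dotProduct_neg]
      exact h
  · rw [← ENNReal.ofReal_add (by positivity) (by positivity)]
    refine ENNReal.ofReal_le_ofReal ?_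
    rw [Real.rpow_neg hN0.le, Real.rpow_one, ← two_mul, sq, mul_inv, ← mul_assoc]
    have : 2 * (N : ℝ)⁻¹ ≤ 1 := by
      rw [← div_eq_mul_inv, div_le_one hN0]; exact hN'
    exact mul_le_of_le_one_left (by positivity) this
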